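/- arXiv:2010.08166 — 2 statements merged into one kernel-verified Lean document; each statement's English description precedes it below -/
import Mathlib

section
/- Let D ⊂ ℝ² be a compact domain with smooth boundary, ε > 0, and u ∈ C¹(ℝ²). Let ψ be harmonic on int(D) and continuous on D with ψ = u on ∂D, and let ψ_ε be harmonic on int(D^{2ε}) and continuous on D^{2ε} with ψ_ε = u on ∂D^{2ε}, where D^{2ε} is the outer 2ε-neighborhood of D. Assume |∇u| ≤ C₁ on D^{2ε}, |∇ψ_ε| ≤ C₁ on D^{2ε}, and every point of ∂D lies within distance 4ε of ∂D^{2ε}. Then sup_{x ∈ D} |ψ(x) − ψ_ε(x)| ≤ 8 ε C₁. -/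
open MeasureTheory Filter Topology
open scoped Classical

noncomputable section

/-- The outer `ε`-neighborhood `D^ε` of a set `D ⊆ ℂ ≅ ℝ²`. -/
def outerNbhd (ε : ℝ) (D : Set ℂ) : Set ℂ := {x | ∃ y ∈ D, dist x y ≤ ε}

/-- `f` is harmonic on `U ⊆ ℂ ≅ ℝ²`: it is `C²` there and its Laplacian vanishes. -/
def HarmonicOn (f : ℂ → ℝ) (U : Set ℂ) : Prop :=
  ContDiffOn ℝ 2 f U ∧ ∀ z ∈ U,
    deriv (fun t : ℝ => deriv (fun a : ℝ => f (z + a)) t) 0 +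
      deriv (fun t : ℝ => deriv (fun b : ℝ => f (z + b * Complex.I)) t) 0 = 0

theorem aux_second {g : ℝ → ℝ} (hg : ContDiffAt ℝ 2 g 0) (hm : IsLocalMax g 0) :
    iteratedDeriv 2 g 0 ≤ 0 := by
  by_contra! h
  rw [iteratedDeriv_succ, iteratedDeriv_one] at h
  have h1 := isLocalMin_of_deriv_deriv_pos h hm.deriv_eq_zero hg.continuousAt
  have h2 : g =ᶠ[𝓝 0] fun _ => g 0 := by
    filter_upwards [hm, h1] with t a b
    exact le_antisymm a b
  have h3 : deriv g =ᶠ[𝓝 0] deriv (fun _ => g 0) := h2.deriv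
  have h4 := h3.deriv_eq
  simp at h4
  linarith

theorem aux_slice {f : ℂ → ℝ} {z : ℂ} (w : ℂ) (hf : ContDiffAt ℝ 2 f z) :
    ContDiffAt ℝ 2 (fun t : ℝ => f (z + t * w)) 0 := by
  have h : ContDiffAt ℝ 2 (fun t : ℝ => z + (t : ℂ) * w) 0 := by
    have : ContDiff ℝ 2 (fun t : ℝ => (t : ℂ)) := Complex.ofRealCLM.contDiff
    exact (contDiff_const.add (this.mul contDiff_const)).contDiffAt
  refine ContDiffAt.comp (g := f) (0 : ℝ) ?_ h
  simpa using hf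

def auxLap (f : ℂ → ℝ) (z : ℂ) : ℝ :=
  iteratedDeriv 2 (fun t : ℝ => f (z + t * (1 : ℂ))) 0
    + iteratedDeriv 2 (fun t : ℝ => f (z + t * Complex.I)) 0

theorem auxLap_add {f g : ℂ → ℝ} {z : ℂ} (hf : ContDiffAt ℝ 2 f z) (hg : ContDiffAt ℝ 2 g z) :
    auxLap (fun x => f x + g x) z = auxLap f z + auxLap g z := by
  unfold auxLap
  have h1 := iteratedDeriv_add (n := 2) (aux_slice 1 hf) (aux_slice 1 hg)
  have h2 := iteratedDeriv_add (n := 2) (aux_slice Complex.I hf) (aux_slice Complex.I hg)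
  simp only [Pi.add_def] at h1 h2
  rw [h1, h2]
  ring

theorem auxLap_sub {f g : ℂ → ℝ} {z : ℂ} (hf : ContDiffAt ℝ 2 f z) (hg : ContDiffAt ℝ 2 g z) :
    auxLap (fun x => f x - g x) z = auxLap f z - auxLap g z := by
  have h := auxLap_add (f := fun x => f x - g x) (g := g) (hf.sub hg) hg
  simp only [sub_add_cancel] at h
  have : auxLap (fun x => f x) z = auxLap f z := rfl
  linarith

theorem aux_harm {f : ℂ → ℝ} {U : Set ℂ} (h : HarmonicOn f U) {z : ℂ} (hz : z ∈ U) :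
    auxLap f z = 0 := by
  have := h.2 z hz
  unfold auxLap
  simp only [iteratedDeriv_succ, iteratedDeriv_zero, mul_one]
  exact this

theorem aux_quad (δ a b : ℝ) : iteratedDeriv 2 (fun t : ℝ => δ * ((a + t) ^ 2 + b)) 0 = 2 * δ := by
  have h1 : deriv (fun t : ℝ => δ * ((a + t) ^ 2 + b)) = fun t => δ * (2 * (a + t)) := by
    funext t
    have h : HasDerivAt (fun t : ℝ => a + t) 1 t := (hasDerivAt_id t).const_add a
    have h2 := ((h.pow 2).add_const b).const_mul δ
    refine h2.deriv.trans ?_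
    norm_num
  rw [iteratedDeriv_succ, iteratedDeriv_one, h1]
  have h : HasDerivAt (fun t : ℝ => a + t) 1 0 := (hasDerivAt_id (0 : ℝ)).const_add a
  refine ((h.const_mul 2).const_mul δ).deriv.trans ?_
  ring

theorem auxLap_quad (δ : ℝ) (z : ℂ) : auxLap (fun x => δ * (x.re ^ 2 + x.im ^ 2)) z = 4 * δ := by
  unfold auxLap
  have h1 := aux_quad δ z.re (z.im ^ 2)
  have h2 := aux_quad δ z.im (z.re ^ 2)
  simp only [Complex.add_re, Complex.add_im, Complex.mul_re, Complex.mul_im, Complex.ofReal_re,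
    Complex.ofReal_im, Complex.one_re, Complex.one_im, Complex.I_re, Complex.I_im, mul_one,
    mul_zero, zero_mul, sub_zero, add_zero, zero_add]
  rw [h1]
  simp only [add_comm (z.re ^ 2)]
  rw [h2]
  ring

theorem aux_max {K : Set ℂ} (hK : IsCompact K) {v : ℂ → ℝ} (hc : ContinuousOn v K)
    (hd : ∀ z ∈ interior K, ContDiffAt ℝ 2 v z) (hl : ∀ z ∈ interior K, auxLap v z = 0)
    {M : ℝ} (hM : ∀ z ∈ frontier K, v z ≤ M) : ∀ z ∈ K, v z ≤ M := by
  intro x hx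
  by_contra! hlt
  have hqc : Continuous (fun z : ℂ => z.re ^ 2 + z.im ^ 2) := by fun_prop
  obtain ⟨R, hR⟩ := (hK.image hqc).bddAbove
  have hR' : ∀ z ∈ K, z.re ^ 2 + z.im ^ 2 ≤ R := fun z hz => hR ⟨z, hz, rfl⟩
  have hR0 : 0 ≤ R := le_trans (by positivity) (hR' x hx)
  set δ := (v x - M) / (2 * (R + 1)) with hδ
  have hδ0 : 0 < δ := by
    apply div_pos <;> linarith
  have hδR : δ * R < v x - M := by
    have : δ * (2 * (R + 1)) = v x - M := by rw [hδ]; field_simp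
    nlinarith
  have hwc : ContinuousOn (fun z : ℂ => v z + δ * (z.re ^ 2 + z.im ^ 2)) K :=
    hc.add (continuous_const.mul hqc).continuousOn
  obtain ⟨z0, hz0, hmax⟩ := hK.exists_isMaxOn ⟨x, hx⟩ hwc
  have hge : v x + δ * (x.re ^ 2 + x.im ^ 2) ≤ v z0 + δ * (z0.re ^ 2 + z0.im ^ 2) := hmax hx
  have hq0 : 0 ≤ δ * (x.re ^ 2 + x.im ^ 2) := by positivity
  have hq1 : δ * (z0.re ^ 2 + z0.im ^ 2) ≤ δ * R :=
    mul_le_mul_of_nonneg_left (hR' z0 hz0) hδ0.le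
  have hint : z0 ∈ interior K := by
    by_contra hn
    have := hM z0 ⟨subset_closure hz0, hn⟩
    linarith
  have hlm : IsLocalMax (fun z : ℂ => v z + δ * (z.re ^ 2 + z.im ^ 2)) z0 :=
    hmax.isLocalMax (mem_interior_iff_mem_nhds.1 hint)
  have hqd : ContDiffAt ℝ 2 (fun z : ℂ => δ * (z.re ^ 2 + z.im ^ 2)) z0 := by
    have h1 : ContDiff ℝ 2 (fun z : ℂ => z.re) := Complex.reCLM.contDiff
    have h2 : ContDiff ℝ 2 (fun z : ℂ => z.im) := Complex.imCLM.contDiff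
    exact (contDiff_const.mul ((h1.pow 2).add (h2.pow 2))).contDiffAt
  have hwd := (hd z0 hint).add hqd
  have key : ∀ w : ℂ, iteratedDeriv 2
      (fun t : ℝ => (fun z : ℂ => v z + δ * (z.re ^ 2 + z.im ^ 2)) (z0 + t * w)) 0 ≤ 0 := by
    intro w
    refine aux_second (aux_slice w hwd) ?_
    have ht : Tendsto (fun t : ℝ => z0 + (t : ℂ) * w) (𝓝 0) (𝓝 z0) := by
      have : Continuous (fun t : ℝ => z0 + (t : ℂ) * w) := by fun_prop
      simpa using this.tendsto 0
    have := ht.eventually hlm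
    simpa [IsLocalMax, IsMaxFilter] using this
  have hL := auxLap_add (hd z0 hint) hqd
  rw [hl z0 hint, auxLap_quad] at hL
  have := add_le_add (key 1) (key Complex.I)
  unfold auxLap at hL
  linarith

theorem aux_closed {D : Set ℂ} (hD : IsCompact D) (r : ℝ) : IsClosed (outerNbhd r D) := by
  rcases lt_or_ge r 0 with hr | hr
  · have : outerNbhd r D = ∅ := by
      ext x
      simp only [outerNbhd, Set.mem_setOf_eq, Set.mem_empty_iff_false, iff_false]
      rintro ⟨y, _, h⟩
      linarith [dist_nonneg (x := x) (y := y)]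
    rw [this]; exact isClosed_empty
  · have : outerNbhd r D = Metric.cthickening r D := by
      rw [hD.cthickening_eq_biUnion_closedBall hr]
      ext x
      simp [outerNbhd]
    rw [this]; exact Metric.isClosed_cthickening

theorem aux_ball_sub {N : Set ℂ} {x : ℂ} (hx : x ∈ interior N) {d : ℝ} (hd : 0 < d)
    (h : ∀ y ∈ frontier N, d ≤ dist x y) : Metric.ball x d ⊆ interior N := by
  have hpre : IsPreconnected (Metric.ball x d) := (convex_ball x d).isPreconnected
  have hcov : Metric.ball x d ⊆ interior N ∪ (closure N)ᶜ := by
    intro y hy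
    by_contra hn
    simp only [Set.mem_union, Set.mem_compl_iff, not_or, not_not] at hn
    have := h y ⟨hn.2, hn.1⟩
    rw [Metric.mem_ball, dist_comm] at hy
    linarith
  intro y hy
  by_contra hn
  obtain ⟨w, _, hw1, hw2⟩ := hpre (interior N) (closure N)ᶜ isOpen_interior
    isClosed_closure.isOpen_compl hcov ⟨x, Metric.mem_ball_self hd, hx⟩
    ⟨y, hy, (hcov hy).resolve_left hn⟩
  exact hw2 (subset_closure (interior_subset hw1))

theorem aux_lip {f : ℂ → ℝ} {x x' : ℂ} {C d : ℝ} (hd : 0 < d) (hxx : dist x x' = d)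
    (hc : ContinuousOn f (Metric.closedBall x d))
    (hdiff : ∀ y ∈ Metric.ball x d, DifferentiableAt ℝ f y)
    (hb : ∀ y ∈ Metric.ball x d, ‖fderiv ℝ f y‖ ≤ C) : |f x' - f x| ≤ C * d := by
  have h1 : ∀ y ∈ Metric.ball x d, ‖f y - f x‖ ≤ C * ‖y - x‖ := fun y hy =>
    (convex_ball x d).norm_image_sub_le_of_norm_fderiv_le hdiff hb (Metric.mem_ball_self hd) hy
  have hcl : closure (Metric.ball x d) = Metric.closedBall x d := closure_ball x hd.ne'
  have hx' : x' ∈ closure (Metric.ball x d) := by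
    rw [hcl, Metric.mem_closedBall, dist_comm, hxx]
  rw [← hcl] at hc
  have h2 := le_on_closure (f := fun y => ‖f y - f x‖) (g := fun y => C * ‖y - x‖) h1
    (hc.sub continuousOn_const).norm (by fun_prop) hx'
  simp only [Real.norm_eq_abs] at h2
  rwa [← dist_eq_norm x' x, dist_comm, hxx] at h2

/-- **Lemma (comparison of Dirichlet solutions on a domain and on its outer
neighborhood).** Let `D ⊆ ℝ²` be a compact domain with smooth boundary, `ε > 0` and
`u ∈ C¹(ℝ²)`. Let `ψ` solve the Dirichlet problem for `u` on `D` and `ψ_ε` solve it on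
`D^{2ε}`. If `|∇u| ≤ C₁` and `|∇ψ_ε| ≤ C₁` on `D^{2ε}`, and every point of `∂D` lies
within distance `4ε` of `∂D^{2ε}`, then `sup_{D} |ψ − ψ_ε| ≤ 8εC₁`. -/
theorem dirichlet_neighborhood_comparison
    (D : Set ℂ) (hD : IsCompact D) (hDdom : D = closure (interior D))
    (hDsmooth : ∃ γ : ℝ → ℂ, ContDiff ℝ (⊤ : ℕ∞) γ ∧ Function.Periodic γ 1 ∧
      (∀ t, deriv γ t ≠ 0) ∧ frontier D = Set.range γ)
    (ε C₁ : ℝ) (hε : 0 < ε)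
    (u : ℂ → ℝ) (hu : ContDiff ℝ 1 u)
    (ψ ψε : ℂ → ℝ)
    (hψ_harm : HarmonicOn ψ (interior D))
    (hψ_cont : ContinuousOn ψ D)
    (hψ_bdry : ∀ x ∈ frontier D, ψ x = u x)
    (hψε_harm : HarmonicOn ψε (interior (outerNbhd (2 * ε) D)))
    (hψε_cont : ContinuousOn ψε (outerNbhd (2 * ε) D))
    (hψε_bdry : ∀ x ∈ frontier (outerNbhd (2 * ε) D), ψε x = u x)
    (hgrad_u : ∀ x ∈ outerNbhd (2 * ε) D, ‖fderiv ℝ u x‖ ≤ C₁)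
    (hgrad_ψε : ∀ x ∈ outerNbhd (2 * ε) D,
      ‖fderivWithin ℝ ψε (outerNbhd (2 * ε) D) x‖ ≤ C₁)
    (hnear : ∀ x ∈ frontier D, ∃ x' ∈ frontier (outerNbhd (2 * ε) D), dist x x' ≤ 4 * ε) :
    ∀ x ∈ D, |ψ x - ψε x| ≤ 8 * ε * C₁ := by
  have hDN : D ⊆ interior (outerNbhd (2 * ε) D) := by
    intro y hy
    refine mem_interior.2 ⟨Metric.ball y (2 * ε), ?_, Metric.isOpen_ball,
      Metric.mem_ball_self (by linarith)⟩
    intro z hz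
    exact ⟨y, hy, (Metric.mem_ball.1 hz).le⟩
  have hNc := aux_closed hD (2 * ε)
  set N := outerNbhd (2 * ε) D with hN
  have hεd : ∀ z ∈ interior N, ContDiffAt ℝ 2 ψε z := fun z hz =>
    hψε_harm.1.contDiffAt (isOpen_interior.mem_nhds hz)
  have hψd : ∀ z ∈ interior D, ContDiffAt ℝ 2 ψ z := fun z hz =>
    hψ_harm.1.contDiffAt (isOpen_interior.mem_nhds hz)
  have hfr : ∀ x ∈ frontier D, |ψ x - ψε x| ≤ 8 * ε * C₁ := by
    intro x hx
    have hxD : x ∈ D := hD.isClosed.frontier_subset hx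
    have hxN := hDN hxD
    have hC : 0 ≤ C₁ := (norm_nonneg _).trans (hgrad_u x (interior_subset hxN))
    obtain ⟨x₁, hx₁, hx₁d⟩ := hnear x hx
    obtain ⟨x', hx', hinf⟩ := (isClosed_frontier (s := N)).exists_infDist_eq_dist ⟨x₁, hx₁⟩ x
    have hmin : ∀ y ∈ frontier N, dist x x' ≤ dist x y := fun y hy =>
      hinf ▸ Metric.infDist_le_dist_of_mem hy
    have hd4 : dist x x' ≤ 4 * ε := (hmin x₁ hx₁).trans hx₁d
    have hd0 : 0 < dist x x' := by
      rw [dist_pos]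
      rintro rfl
      exact hx'.2 hxN
    have hball := aux_ball_sub hxN hd0 hmin
    have hcb : Metric.closedBall x (dist x x') ⊆ N := by
      rw [← closure_ball x hd0.ne']
      exact closure_minimal (hball.trans interior_subset) hNc
    have e1 := aux_lip (f := u) (C := C₁) hd0 rfl hu.continuous.continuousOn
      (fun y _ => (hu.differentiable one_ne_zero) y)
      (fun y hy => hgrad_u y (interior_subset (hball hy)))
    have e2 := aux_lip (f := ψε) (C := C₁) hd0 rfl (hψε_cont.mono hcb)
      (fun y hy => (hεd y (hball hy)).differentiableAt two_ne_zero)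
      (fun y hy => by
        have := hgrad_ψε y (interior_subset (hball hy))
        rwa [fderivWithin_of_mem_nhds (mem_interior_iff_mem_nhds.1 (hball hy))] at this)
    rw [hψε_bdry x' hx'] at e2
    rw [hψ_bdry x hx]
    have e3 : C₁ * dist x x' ≤ C₁ * (4 * ε) := mul_le_mul_of_nonneg_left hd4 hC
    rw [abs_le] at *
    constructor <;> linarith
  have hsub : interior D ⊆ interior N := interior_subset.trans hDN
  have hc2 := hψε_cont.mono (hDN.trans interior_subset)
  intro x hx
  have m1 := aux_max hD (v := fun z => ψ z - ψε z) (hψ_cont.sub hc2)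
    (fun z hz => (hψd z hz).sub (hεd z (hsub hz)))
    (fun z hz => by
      rw [auxLap_sub (hψd z hz) (hεd z (hsub hz)), aux_harm hψ_harm hz,
        aux_harm hψε_harm (hsub hz), sub_zero])
    (fun z hz => (abs_le.1 (hfr z hz)).2) x hx
  have m2 := aux_max hD (v := fun z => ψε z - ψ z) (hc2.sub hψ_cont)
    (fun z hz => (hεd z (hsub hz)).sub (hψd z hz))
    (fun z hz => by
      rw [auxLap_sub (hεd z (hsub hz)) (hψd z hz), aux_harm hψ_harm hz,
        aux_harm hψε_harm (hsub hz), sub_zero])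
    (M := 8 * ε * C₁) (fun z hz => by linarith [(abs_le.1 (hfr z hz)).1]) x hx
  rw [abs_le]
  constructor <;> linarith

end
end

section
/- Let 1 < r_q ≤ r_p and φ ∈ ℝ, and assume e^{iφ} r_q / r_p ≠ 1. Then Σ_{j=0}^∞ (1/(j+1)) (e^{iφ}/(r_p r_q))^{j+1} ( r_q^{2(j+1)} − 1 − (r_q² − 1)^{j+1} ) = −[ Log(1 − e^{iφ} r_q/r_p) − Log(1 − e^{iφ}/(r_p r_q)) − Log(1 − e^{iφ}(r_q² − 1)/(r_p r_q)) ], where Log denotes the principal branch of the complex logarithm; the series converges since r_q/r_p ≤ 1, 1/(r_p r_q) < 1, and (r_q² − 1)/(r_p r_q) < 1. -/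
open Filter Topology

noncomputable section

/-- The Mercator series on the closed unit disk minus `1`. -/
lemma aux_log_tendsto (z : ℂ) (hz : ‖z‖ ≤ 1) (hz1 : z ≠ 1) :
    Tendsto (fun K : ℕ => ∑ j ∈ Finset.range K, z ^ (j + 1) / ((j : ℂ) + 1)) atTop
      (𝓝 (-Complex.log (1 - z))) := by
  have hsub : 1 - z ≠ 0 := sub_ne_zero.mpr (Ne.symm hz1)
  -- convergence by Dirichlet's test
  have hanti : Antitone (fun n : ℕ => 1 / ((n : ℝ) + 1)) := fun a b hab =>
    Nat.one_div_le_one_div hab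
  have hb : ∀ n : ℕ, ‖∑ i ∈ Finset.range n, z ^ (i + 1)‖ ≤ 2 / ‖1 - z‖ := by
    intro n
    have e : ∑ i ∈ Finset.range n, z ^ (i + 1) = z * (1 - z ^ n) / (1 - z) := by
      rw [eq_div_iff hsub]
      have := geom_sum_mul z n
      simp only [pow_succ]
      rw [← Finset.sum_mul]
      linear_combination (-z) * this
    rw [e, norm_div, norm_mul]
    gcongr
    have h3 : ‖1 - z ^ n‖ ≤ 2 := by
      calc ‖1 - z ^ n‖ ≤ ‖(1 : ℂ)‖ + ‖z ^ n‖ := norm_sub_le _ _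
        _ ≤ 1 + 1 := by
          rw [norm_one, norm_pow]
          gcongr
          exact pow_le_one₀ (norm_nonneg _) hz
        _ = 2 := by norm_num
    calc ‖z‖ * ‖1 - z ^ n‖ ≤ 1 * 2 := by gcongr
      _ = 2 := by norm_num
  have hc := hanti.cauchySeq_series_mul_of_tendsto_zero_of_bounded
    tendsto_one_div_add_atTop_nhds_zero_nat hb
  obtain ⟨l, hl⟩ := cauchySeq_tendsto_of_complete hc
  have hl' : Tendsto (fun K : ℕ => ∑ j ∈ Finset.range K, z ^ (j + 1) / ((j : ℂ) + 1)) atTop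
      (𝓝 l) := by
    refine hl.congr fun K => Finset.sum_congr rfl fun j _ => ?_
    rw [Complex.real_smul]
    push_cast
    ring
  -- identify the limit by Abel's theorem
  have hA := Complex.tendsto_tsum_powerSeries_nhdsWithin_lt hl'
  have hx : Tendsto (fun x : ℝ => (x : ℂ)) (𝓝[<] 1) (𝓝 1) := by
    have := (Complex.continuous_ofReal.tendsto (1 : ℝ))
    simp only [Complex.ofReal_one] at this
    exact this.mono_left nhdsWithin_le_nhds
  have hA' : Tendsto (fun x : ℝ => ∑' n : ℕ, z ^ (n + 1) / ((n : ℂ) + 1) * (x : ℂ) ^ n)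
      (𝓝[<] 1) (𝓝 l) := tendsto_map'_iff.mp hA
  have hB := hx.mul hA'
  rw [one_mul] at hB
  have hslit : 1 - z ∈ Complex.slitPlane := by
    rw [Complex.mem_slitPlane_iff]
    by_contra hcon
    push Not at hcon
    obtain ⟨hre, him⟩ := hcon
    have h5 : z.re ≤ 1 := (Complex.re_le_norm z).trans hz
    simp only [Complex.sub_re, Complex.one_re, Complex.sub_im, Complex.one_im] at hre him
    apply hz1
    apply Complex.ext
    · simp only [Complex.one_re]; linarith
    · simp only [Complex.one_im]; linarith
  have hC : Tendsto (fun x : ℝ => -Complex.log (1 - (x : ℂ) * z)) (𝓝[<] 1)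
      (𝓝 (-Complex.log (1 - z))) := by
    have h6 : Tendsto (fun x : ℝ => 1 - (x : ℂ) * z) (𝓝[<] 1) (𝓝 (1 - z)) := by
      simpa using (hx.mul_const z).const_sub 1
    exact (h6.clog hslit).neg
  have hD : (fun x : ℝ => (x : ℂ) * ∑' n : ℕ, z ^ (n + 1) / ((n : ℂ) + 1) * (x : ℂ) ^ n)
      =ᶠ[𝓝[<] 1] fun x : ℝ => -Complex.log (1 - (x : ℂ) * z) := by
    filter_upwards [Ioo_mem_nhdsLT (zero_lt_one' ℝ)] with x hx01
    have hn : ‖(x : ℂ) * z‖ < 1 := by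
      rw [norm_mul, Complex.norm_real, Real.norm_of_nonneg hx01.1.le]
      nlinarith [hx01.1, hx01.2, norm_nonneg z]
    rw [← (Complex.hasSum_taylorSeries_neg_log' hn).tsum_eq, ← tsum_mul_left]
    refine tsum_congr fun n => ?_
    rw [mul_pow]
    ring
  rw [tendsto_nhds_unique hC (hB.congr' hD)]
  exact hl'

theorem log_series_summation (rp rq φ : ℝ) (h1 : 1 < rq) (h2 : rq ≤ rp)
    (hne : Complex.exp (Complex.I * (φ : ℂ)) * (rq : ℂ) / (rp : ℂ) ≠ 1) :
    Tendsto (fun K : ℕ => ∑ j ∈ Finset.range K,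
        (1 / ((j : ℂ) + 1)) * (Complex.exp (Complex.I * (φ : ℂ)) / ((rp : ℂ) * rq)) ^ (j + 1) *
          ((rq : ℂ) ^ (2 * (j + 1)) - 1 - ((rq : ℂ) ^ 2 - 1) ^ (j + 1)))
      atTop
      (𝓝 (-(Complex.log (1 - Complex.exp (Complex.I * (φ : ℂ)) * rq / rp) -
            Complex.log (1 - Complex.exp (Complex.I * (φ : ℂ)) / ((rp : ℂ) * rq)) -
            Complex.log (1 - Complex.exp (Complex.I * (φ : ℂ)) * ((rq : ℂ) ^ 2 - 1) /
              ((rp : ℂ) * rq))))) := by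
  have hE : ‖Complex.exp (Complex.I * (φ : ℂ))‖ = 1 := by
    rw [mul_comm]; exact Complex.norm_exp_ofReal_mul_I φ
  set E := Complex.exp (Complex.I * (φ : ℂ)) with hEdef
  have hq0 : 0 < rq := by linarith
  have hp0 : 0 < rp := by linarith
  have hqC : (rq : ℂ) ≠ 0 := by exact_mod_cast hq0.ne'
  have hpC : (rp : ℂ) ≠ 0 := by exact_mod_cast hp0.ne'
  have hpq : 0 < rp * rq := by positivity
  have key : ∀ w : ℂ, ‖w‖ < 1 → w ≠ 1 := by
    rintro w hw rfl
    simp at hw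
  have nA : ‖E * rq / rp‖ ≤ 1 := by
    rw [norm_div, norm_mul, hE, Complex.norm_real, Complex.norm_real,
      Real.norm_of_nonneg hq0.le, Real.norm_of_nonneg hp0.le, one_mul, div_le_one hp0]
    exact h2
  have nB : ‖E / ((rp : ℂ) * rq)‖ < 1 := by
    rw [norm_div, norm_mul, hE, Complex.norm_real, Complex.norm_real,
      Real.norm_of_nonneg hq0.le, Real.norm_of_nonneg hp0.le, div_lt_one hpq]
    nlinarith
  have nC : ‖E * ((rq : ℂ) ^ 2 - 1) / ((rp : ℂ) * rq)‖ < 1 := by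
    have e : ((rq : ℂ) ^ 2 - 1) = ((rq ^ 2 - 1 : ℝ) : ℂ) := by push_cast; ring
    rw [e, norm_div, norm_mul, norm_mul, hE, Complex.norm_real, Complex.norm_real,
      Complex.norm_real, Real.norm_of_nonneg hq0.le, Real.norm_of_nonneg hp0.le,
      Real.norm_of_nonneg (by nlinarith), div_lt_one hpq]
    nlinarith
  have tA := aux_log_tendsto _ nA hne
  have tB := aux_log_tendsto _ nB.le (key _ nB)
  have tC := aux_log_tendsto _ nC.le (key _ nC)
  have t := (tA.sub tB).sub tC
  have hlim : ∀ a b c : ℂ, -(a - b - c) = -a - -b - -c := fun a b c => by ring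
  rw [hlim]
  refine t.congr fun K => ?_
  rw [← Finset.sum_sub_distrib, ← Finset.sum_sub_distrib]
  refine Finset.sum_congr rfl fun j _ => ?_
  have eA : E * (rq : ℂ) / rp = E / ((rp : ℂ) * rq) * (rq : ℂ) ^ 2 := by
    field_simp
  have eC : E * ((rq : ℂ) ^ 2 - 1) / ((rp : ℂ) * rq) = E / ((rp : ℂ) * rq) * ((rq : ℂ) ^ 2 - 1) := by
    ring
  rw [eA, eC, mul_pow _ ((rq : ℂ) ^ 2), mul_pow _ ((rq : ℂ) ^ 2 - 1), pow_mul]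
  ring

end
end
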